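/- Let Qⁿ ⊆ ℝⁿ be the n-dimensional cube of edge length w (n ≥ 2). A convex body Φ ⊆ ℝⁿ is a rotor of Qⁿ if and only if Φ has constant width w, i.e. the support function h of Φ satisfies h(u) + h(−u) = w for every unit vector u. -/

import Mathlib

open Real Set
open scoped InnerProductSpace

noncomputable section

/-- The cube `[0, w]ⁿ` in Euclidean `n`-space. -/
def cube (n : ℕ) (w : ℝ) : Set (EuclideanSpace ℝ (Fin n)) :=
  {y | ∀ i : Fin n, y i ∈ Set.Icc (0 : ℝ) w}

/-- The cube `[0, w]ⁿ` is circumscribed about a convex body `φ`: `φ` is contained in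
the cube and each facet lies on a support hyperplane of `φ`; since `φ` is inside the
cube, the latter amounts to `φ` touching each of the `2n` facet hyperplanes. -/
def CubeCircumscribed (n : ℕ) (w : ℝ) (φ : Set (EuclideanSpace ℝ (Fin n))) : Prop :=
  φ ⊆ cube n w ∧ ∀ i : Fin n, (∃ y ∈ φ, y i = 0) ∧ (∃ y ∈ φ, y i = w)

/-- `φ` is a rotor in the cube `[0, w]ⁿ` if for every rotation `ρ`
(orientation-preserving linear isometry) there is a translation `τ` such that the cube
is circumscribed about `τ(ρ(φ))`. -/
def IsRotorInCube (n : ℕ) (w : ℝ) (φ : Set (EuclideanSpace ℝ (Fin n))) : Prop :=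
  ∀ ρ : EuclideanSpace ℝ (Fin n) ≃ₗᵢ[ℝ] EuclideanSpace ℝ (Fin n),
    0 < LinearMap.det (ρ.toLinearEquiv : EuclideanSpace ℝ (Fin n) →ₗ[ℝ] EuclideanSpace ℝ (Fin n)) →
    ∃ τ : EuclideanSpace ℝ (Fin n), CubeCircumscribed n w ((fun y => ρ y + τ) '' φ)

/-- The support function of a set: `h(u) = sup {⟪x, u⟫ : x ∈ φ}`. -/
def supportFn {n : ℕ} (φ : Set (EuclideanSpace ℝ (Fin n))) (u : EuclideanSpace ℝ (Fin n)) : ℝ :=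
  sSup ((fun x => ⟪x, u⟫_ℝ) '' φ)

lemma inner_le_supportFn {n : ℕ} {φ : Set (EuclideanSpace ℝ (Fin n))} (hφ : IsCompact φ)
    (u : EuclideanSpace ℝ (Fin n)) {x : EuclideanSpace ℝ (Fin n)} (hx : x ∈ φ) :
    ⟪x, u⟫_ℝ ≤ supportFn φ u :=
  le_csSup (hφ.image (by fun_prop)).bddAbove (mem_image_of_mem _ hx)

lemma exists_inner_eq_supportFn {n : ℕ} {φ : Set (EuclideanSpace ℝ (Fin n))} (hφ : IsCompact φ)
    (hne : φ.Nonempty) (u : EuclideanSpace ℝ (Fin n)) : ∃ x ∈ φ, ⟪x, u⟫_ℝ = supportFn φ u :=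
  (hφ.image (by fun_prop)).sSup_mem (hne.image _)

lemma apply_eq_inner_symm_single {n : ℕ}
    (ρ : EuclideanSpace ℝ (Fin n) ≃ₗᵢ[ℝ] EuclideanSpace ℝ (Fin n)) (i : Fin n)
    (x : EuclideanSpace ℝ (Fin n)) :
    ρ x i = ⟪x, ρ.symm (EuclideanSpace.single i 1)⟫_ℝ := by
  rw [← ρ.inner_map_map, ρ.apply_symm_apply, EuclideanSpace.inner_single_right]
  simp

/-- A rotation can carry any unit vector to any vector of the standard basis. -/
lemma exists_rotation_map_eq_single {n : ℕ} {i j : Fin n} (hij : i ≠ j)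
    {u : EuclideanSpace ℝ (Fin n)} (hu : ‖u‖ = 1) :
    ∃ ρ : EuclideanSpace ℝ (Fin n) ≃ₗᵢ[ℝ] EuclideanSpace ℝ (Fin n),
      0 < LinearMap.det
        (ρ.toLinearEquiv : EuclideanSpace ℝ (Fin n) →ₗ[ℝ] EuclideanSpace ℝ (Fin n)) ∧
      ρ u = EuclideanSpace.single i 1 := by
  obtain ⟨ρ, hρ⟩ : ∃ ρ : EuclideanSpace ℝ (Fin n) ≃ₗᵢ[ℝ] EuclideanSpace ℝ (Fin n),
      ρ u = EuclideanSpace.single i 1 :=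
    ⟨_, Submodule.reflection_sub (by simp [hu])⟩
  rcases (LinearEquiv.isUnit_det' ρ.toLinearEquiv).ne_zero.lt_or_gt with h | h
  · let e : EuclideanSpace ℝ (Fin n) := EuclideanSpace.single j 1
    have he : e ≠ 0 := by simp [e]
    refine ⟨ρ.trans (ℝ ∙ e)ᗮ.reflection, ?_, ?_⟩
    · have hdet : LinearMap.det ((ℝ ∙ e)ᗮ.reflection.toLinearEquiv :
          EuclideanSpace ℝ (Fin n) →ₗ[ℝ] EuclideanSpace ℝ (Fin n)) = -1 :=
        (ℝ ∙ e)ᗮ.det_reflection.trans <| by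
          rw [Submodule.orthogonal_orthogonal, finrank_span_singleton he, pow_one]
      have hcomp : ((ρ.trans (ℝ ∙ e)ᗮ.reflection).toLinearEquiv :
          EuclideanSpace ℝ (Fin n) →ₗ[ℝ] EuclideanSpace ℝ (Fin n)) =
          ((ℝ ∙ e)ᗮ.reflection.toLinearEquiv :
            EuclideanSpace ℝ (Fin n) →ₗ[ℝ] EuclideanSpace ℝ (Fin n)) ∘ₗ
          (ρ.toLinearEquiv : EuclideanSpace ℝ (Fin n) →ₗ[ℝ] EuclideanSpace ℝ (Fin n)) := rfl
      rw [hcomp, LinearMap.det_comp, hdet]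
      linarith
    · rw [LinearIsometryEquiv.trans_apply, hρ]
      apply Submodule.reflection_mem_subspace_eq_self
      rw [Submodule.mem_orthogonal_singleton_iff_inner_right]
      simp [e, EuclideanSpace.inner_single_left, hij.symm]
  · exact ⟨ρ, h, hρ⟩

/-- **Rotors of the cube are exactly the bodies of constant width.**  A convex body
`Φ ⊆ ℝⁿ` (`n ≥ 2`) is a rotor of the cube `[0, w]ⁿ` if and only if `Φ` has constant
width `w`, i.e. `h(u) + h(−u) = w` for every unit vector `u`. -/
theorem rotor_in_cube_iff_constant_width
    (n : ℕ) (hn : 2 ≤ n) (w : ℝ) (hw : 0 < w)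
    (Φ : Set (EuclideanSpace ℝ (Fin n)))
    (hconv : Convex ℝ Φ) (hcomp : IsCompact Φ) (hint : (interior Φ).Nonempty) :
    IsRotorInCube n w Φ ↔
      ∀ u : EuclideanSpace ℝ (Fin n), ‖u‖ = 1 →
        supportFn Φ u + supportFn Φ (-u) = w := by
  have hne : Φ.Nonempty := hint.mono interior_subset
  constructor
  · intro h u hu
    have hij : (⟨0, by omega⟩ : Fin n) ≠ ⟨1, by omega⟩ := by simp
    obtain ⟨ρ, hdet, hρ⟩ := exists_rotation_map_eq_single hij hu
    obtain ⟨τ, hsub, hface⟩ := h ρ hdet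
    generalize (⟨0, by omega⟩ : Fin n) = i at hρ
    have hcoord (x : EuclideanSpace ℝ (Fin n)) : (ρ x + τ) i = ⟪x, u⟫_ℝ + τ i := by
      rw [PiLp.add_apply, apply_eq_inner_symm_single, ← hρ, ρ.symm_apply_apply]
    have hbound (x) (hx : x ∈ Φ) : 0 ≤ ⟪x, u⟫_ℝ + τ i ∧ ⟪x, u⟫_ℝ + τ i ≤ w := by
      rw [← hcoord]
      exact hsub (mem_image_of_mem _ hx) i
    obtain ⟨⟨_, ⟨a, ha, rfl⟩, ha0⟩, ⟨_, ⟨b, hb, rfl⟩, hbw⟩⟩ := hface i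
    obtain ⟨p, hp, hpu⟩ := exists_inner_eq_supportFn hcomp hne u
    obtain ⟨q, hq, hqu⟩ := exists_inner_eq_supportFn hcomp hne (-u)
    have hau := inner_le_supportFn hcomp (-u) ha
    have hbu := inner_le_supportFn hcomp u hb
    have hpb := hbound p hp
    have hqb := hbound q hq
    simp only [hcoord] at ha0 hbw
    rw [inner_neg_right] at hau hqu
    linarith
  · intro h ρ _
    let v (i : Fin n) : EuclideanSpace ℝ (Fin n) := ρ.symm (EuclideanSpace.single i 1)
    have hwidth (i : Fin n) : supportFn Φ (v i) + supportFn Φ (-v i) = w := h _ (by simp [v])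
    let τ : EuclideanSpace ℝ (Fin n) := WithLp.toLp 2 fun i => supportFn Φ (-v i)
    have hcoord (x : EuclideanSpace ℝ (Fin n)) (i : Fin n) :
        (ρ x + τ) i = ⟪x, v i⟫_ℝ + supportFn Φ (-v i) := by
      rw [PiLp.add_apply, apply_eq_inner_symm_single]
    refine ⟨τ, ?_, fun i => ⟨?_, ?_⟩⟩
    · rintro _ ⟨x, hx, rfl⟩ i
      have hlow := inner_le_supportFn hcomp (-v i) hx
      have hupp := inner_le_supportFn hcomp (v i) hx
      rw [inner_neg_right] at hlow
      simp only [hcoord]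
      constructor <;> linarith [hwidth i]
    · obtain ⟨x, hx, hxv⟩ := exists_inner_eq_supportFn hcomp hne (-v i)
      refine ⟨_, mem_image_of_mem _ hx, ?_⟩
      rw [inner_neg_right] at hxv
      simp only [hcoord]
      linarith
    · obtain ⟨x, hx, hxv⟩ := exists_inner_eq_supportFn hcomp hne (v i)
      refine ⟨_, mem_image_of_mem _ hx, ?_⟩
      simp only [hcoord]
      linarith [hwidth i]
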